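/- Let n ≥ 2. Let ρ : ℝⁿ → ℝ be twice continuously differentiable, let Ω : ℝⁿ → ℝⁿ be twice continuously differentiable with |Ω(x)| = 1 for all x, let η : ℝ → ℝ be twice continuously differentiable, and let h : [−1,1] → ℝ be continuous and odd. Define G(x,u) := e^{η(ρ(x))(u·Ω(x))²}/Z(x) with Z(x) := ∫_{S^{n−1}} e^{η(ρ(x))(v·Ω(x))²} dσ(v), ψ(x,u) := h(u·Ω(x))(u − (u·Ω(x))Ω(x)), c_k(x) := ∫_{S^{n−1}} (u·Ω(x))^k h(u·Ω(x))(1 − (u·Ω(x))²) G(x,u) dσ(u) for k = 1, 3, and d₂₀(x) := ∫_{S^{n−1}} (u·Ω(x))² G(x,u) dσ(u). Then, writing η = η(ρ(x)), η′ = η′(ρ(x)), P_{Ω⊥} = Id − Ω⊗Ω, (∇ρ·∇)Ω = Σ_j ∂_{x_j}ρ ∂_{x_j}Ω and Δ_x the componentwise spatial Laplacian, at every x: ∫_{S^{n−1}} Δ_x( ρ(x) G(x,u) ) ψ(x,u) dσ(u) = (2 η c₁(x)/(n−1)) ρ(x) P_{Ω⊥} Δ_xΩ(x) + (4/(n−1))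 ( ρ(x) η′ [ c₁(x) + η ( c₃(x) − d₂₀(x) c₁(x) ) ] + η c₁(x) ) (∇ρ·∇)Ω(x). -/

import Mathlib

open MeasureTheory Metric
open scoped RealInnerProductSpace

/-- The image of a point of the unit sphere of `ℝⁿ` under a linear isometry. -/
noncomputable def sphereMap {n : ℕ}
    (e : EuclideanSpace ℝ (Fin n) ≃ₗᵢ[ℝ] EuclideanSpace ℝ (Fin n))
    (u : sphere (0 : EuclideanSpace ℝ (Fin n)) 1) :
    sphere (0 : EuclideanSpace ℝ (Fin n)) 1 :=
  ⟨e u, by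
    rw [mem_sphere_zero_iff_norm, e.norm_map]
    exact mem_sphere_zero_iff_norm.mp u.2⟩

/-- A measure on the unit sphere of `ℝⁿ` is rotation invariant if it is invariant under
every linear isometry of `ℝⁿ`. -/
def RotationInvariant {n : ℕ} (σ : Measure (sphere (0 : EuclideanSpace ℝ (Fin n)) 1)) :
    Prop :=
  ∀ e : EuclideanSpace ℝ (Fin n) ≃ₗᵢ[ℝ] EuclideanSpace ℝ (Fin n),
    σ.map (sphereMap e) = σ

/-- The Gibbs density `G_η(u) = e^{η(u·Ω)²}/Z_η` on the unit sphere, with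
`Z_η = ∫ e^{η(v·Ω)²} dσ(v)`. -/
noncomputable def gibbs {n : ℕ} (σ : Measure (sphere (0 : EuclideanSpace ℝ (Fin n)) 1))
    (η : ℝ) (Ω : EuclideanSpace ℝ (Fin n))
    (u : sphere (0 : EuclideanSpace ℝ (Fin n)) 1) : ℝ :=
  Real.exp (η * ⟪(u : EuclideanSpace ℝ (Fin n)), Ω⟫ ^ 2) /
    ∫ v : sphere (0 : EuclideanSpace ℝ (Fin n)) 1,
      Real.exp (η * ⟪(v : EuclideanSpace ℝ (Fin n)), Ω⟫ ^ 2) ∂σ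

/-- Partial derivative `∂_{x_j} f(x)` of a scalar field on `ℝⁿ`. -/
noncomputable def pd {n : ℕ} (j : Fin n) (f : EuclideanSpace ℝ (Fin n) → ℝ)
    (x : EuclideanSpace ℝ (Fin n)) : ℝ :=
  fderiv ℝ f x (EuclideanSpace.single j 1)

/-- Partial derivative `∂_{x_j} f(x)` of a vector field on `ℝⁿ`. -/
noncomputable def pdV {n : ℕ} (j : Fin n)
    (f : EuclideanSpace ℝ (Fin n) → EuclideanSpace ℝ (Fin n))
    (x : EuclideanSpace ℝ (Fin n)) : EuclideanSpace ℝ (Fin n) :=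
  fderiv ℝ f x (EuclideanSpace.single j 1)

/-- The orthogonal projection `P_{Ω⊥} v = v − (v·Ω)Ω` onto `Ω⊥`. -/
noncomputable def projPerp {n : ℕ} (Ω v : EuclideanSpace ℝ (Fin n)) :
    EuclideanSpace ℝ (Fin n) :=
  v - ⟪v, Ω⟫ • Ω

/-- The coefficient `c_k = ∫ (u·Ω)^k h(u·Ω)(1−(u·Ω)²) G_η dσ`. -/
noncomputable def cCoeff {n : ℕ} (σ : Measure (sphere (0 : EuclideanSpace ℝ (Fin n)) 1))
    (h : ℝ → ℝ) (η : ℝ) (Ω : EuclideanSpace ℝ (Fin n)) (k : ℕ) : ℝ :=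
  ∫ u : sphere (0 : EuclideanSpace ℝ (Fin n)) 1,
    ⟪(u : EuclideanSpace ℝ (Fin n)), Ω⟫ ^ k *
      h ⟪(u : EuclideanSpace ℝ (Fin n)), Ω⟫ *
      (1 - ⟪(u : EuclideanSpace ℝ (Fin n)), Ω⟫ ^ 2) * gibbs σ η Ω u ∂σ

/-- The coefficient `d₂₀ = ∫ (u·Ω)² G_η dσ`. -/
noncomputable def dCoeff20 {n : ℕ} (σ : Measure (sphere (0 : EuclideanSpace ℝ (Fin n)) 1))
    (η : ℝ) (Ω : EuclideanSpace ℝ (Fin n)) : ℝ :=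
  ∫ u : sphere (0 : EuclideanSpace ℝ (Fin n)) 1,
    ⟪(u : EuclideanSpace ℝ (Fin n)), Ω⟫ ^ 2 * gibbs σ η Ω u ∂σ


abbrev EE (n : ℕ) := EuclideanSpace ℝ (Fin n)
abbrev SS (n : ℕ) := sphere (0 : EuclideanSpace ℝ (Fin n)) 1

theorem continuous_sphereMap {n : ℕ} (e : EE n ≃ₗᵢ[ℝ] EE n) : Continuous (sphereMap e) := by
  unfold sphereMap
  exact Continuous.subtype_mk (e.continuous.comp continuous_subtype_val) _

theorem integral_sphereMap {n : ℕ} {V : Type*} [NormedAddCommGroup V] [NormedSpace ℝ V]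
    {σ : Measure (SS n)} (hinv : RotationInvariant σ)
    (e : EE n ≃ₗᵢ[ℝ] EE n) (f : SS n → V) :
    ∫ u, f (sphereMap e u) ∂σ = ∫ u, f u ∂σ := by
  have hm : MeasurableEmbedding (sphereMap e) := by
    apply Continuous.measurableEmbedding (continuous_sphereMap e)
    intro u v huv
    apply Subtype.ext
    have := congrArg Subtype.val huv
    simpa [sphereMap] using this
  conv_rhs => rw [← hinv e]
  rw [hm.integral_map]

theorem integrable_sphere {n : ℕ} {V : Type*} [NormedAddCommGroup V] [NormedSpace ℝ V]
    [SecondCountableTopology V]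
    {σ : Measure (SS n)} [IsProbabilityMeasure σ] {f : SS n → V} (hf : Continuous f) :
    Integrable f σ := by
  have : CompactSpace (SS n) := isCompact_iff_compactSpace.mp (isCompact_sphere _ _)
  exact hf.integrable_of_hasCompactSupport (HasCompactSupport.of_compactSpace f)

/-- Even terms vanish. -/
theorem even_vanish {n : ℕ} {σ : Measure (SS n)} (hinv : RotationInvariant σ)
    (w : EE n) (hw : ‖w‖ = 1) (F : SS n → ℝ)
    (hF : ∀ u v : SS n, (v : EE n) = (2 * ⟪(u : EE n), w⟫) • w - u → F v = F u) :
    ∫ u, F u • projPerp w (u : EE n) ∂σ = 0 := by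
  have key := integral_sphereMap hinv (Submodule.reflection (Submodule.span ℝ {w}))
    (fun u => F u • projPerp w (u : EE n))
  have hv : ∀ u : SS n, ((sphereMap (Submodule.reflection (Submodule.span ℝ {w})) u : SS n) : EE n)
      = (2 * ⟪(u : EE n), w⟫) • w - u := by
    intro u
    simp only [sphereMap]
    rw [Submodule.reflection_singleton_apply, hw, real_inner_comm]
    simp [two_smul, mul_smul]
  have hneg : ∀ u : SS n, F (sphereMap (Submodule.reflection (Submodule.span ℝ {w})) u) •
      projPerp w ((sphereMap (Submodule.reflection (Submodule.span ℝ {w})) u : SS n) : EE n)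
      = - (F u • projPerp w (u : EE n)) := by
    intro u
    rw [hF u _ (hv u), hv u, ← smul_neg]
    congr 1
    simp only [projPerp, inner_sub_left, inner_smul_left, real_inner_self_eq_norm_sq, hw]
    simp only [RCLike.conj_to_real]
    module
  simp only [hneg] at key
  rw [integral_neg] at key
  have h2 : (2 : ℝ) • ∫ u, F u • projPerp w (u : EE n) ∂σ = 0 := by
    rw [two_smul]
    nth_rewrite 1 [← key]
    exact neg_add_cancel _
  simpa using h2

theorem inner_projPerp_right {n : ℕ} (Ω u v : EE n) :
    ⟪projPerp Ω u, v⟫ = ⟪u, projPerp Ω v⟫ := by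
  simp only [projPerp, inner_sub_left, inner_smul_left, inner_sub_right, inner_smul_right,
    RCLike.conj_to_real]
  rw [real_inner_comm v Ω]; ring

theorem inner_projPerp_self {n : ℕ} (Ω v : EE n) (hΩ : ‖Ω‖ = 1) : ⟪projPerp Ω v, Ω⟫ = 0 := by
  simp only [projPerp, inner_sub_left, inner_smul_left, RCLike.conj_to_real,
    real_inner_self_eq_norm_sq, hΩ]
  ring

/-- the quadratic form is a multiple of the norm squared on the orthogonal of Ω -/
theorem quad_eq {n : ℕ} {σ : Measure (SS n)} (hinv : RotationInvariant σ)
    (Ω : EE n) (g : ℝ → ℝ) (w v : EE n) (hw : ⟪w, Ω⟫ = 0) (hv : ⟪v, Ω⟫ = 0) :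
    ‖v‖ ^ 2 * ∫ u : SS n, g ⟪(u : EE n), Ω⟫ * ⟪(u : EE n), w⟫ ^ 2 ∂σ =
      ‖w‖ ^ 2 * ∫ u : SS n, g ⟪(u : EE n), Ω⟫ * ⟪(u : EE n), v⟫ ^ 2 ∂σ := by
  have h1 : ∀ a b : EE n, ⟪a, Ω⟫ = 0 → ⟪b, Ω⟫ = 0 → ‖a‖ = ‖b‖ →
      ∫ u : SS n, g ⟪(u : EE n), Ω⟫ * ⟪(u : EE n), a⟫ ^ 2 ∂σ =
      ∫ u : SS n, g ⟪(u : EE n), Ω⟫ * ⟪(u : EE n), b⟫ ^ 2 ∂σ := by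
    intro a b ha hb hab
    set R := Submodule.reflection (Submodule.span ℝ {a - b})ᗮ with hR
    have hRa : R a = b := Submodule.reflection_sub hab
    have hRΩ : R Ω = Ω := by
      apply Submodule.reflection_mem_subspace_eq_self
      rw [Submodule.mem_orthogonal_singleton_iff_inner_right, inner_sub_left, ha, hb, sub_zero]
    rw [← integral_sphereMap hinv R (fun u => g ⟪(u : EE n), Ω⟫ * ⟪(u : EE n), b⟫ ^ 2)]
    congr 1
    ext u
    have e1 : ⟪((sphereMap R u : SS n) : EE n), Ω⟫ = ⟪(u : EE n), Ω⟫ := by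
      conv_lhs => rw [← hRΩ]
      exact R.inner_map_map _ _
    have e2 : ⟪((sphereMap R u : SS n) : EE n), b⟫ = ⟪(u : EE n), a⟫ := by
      conv_lhs => rw [← hRa]
      exact R.inner_map_map _ _
    rw [e1, e2]
  have := h1 (‖v‖ • w) (‖w‖ • v) (by simp [inner_smul_left, hw]) (by simp [inner_smul_left, hv])
    (by simp [norm_smul, mul_comm])
  simp only [inner_smul_right, mul_pow] at this
  rw [← integral_const_mul, ← integral_const_mul]
  calc _ = _ := by congr 1; ext u; ring
    _ = _ := this
    _ = _ := by congr 1; ext u; ring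

theorem quad_trace {n : ℕ} {σ : Measure (SS n)} [IsProbabilityMeasure σ]
    (hinv : RotationInvariant σ)
    (Ω : EE n) (hΩ : ‖Ω‖ = 1) (g : ℝ → ℝ) (hg : Continuous fun u : SS n => g ⟪(u : EE n), Ω⟫)
    (w : EE n) (hw : ⟪w, Ω⟫ = 0) :
    ((n : ℝ) - 1) * ∫ u : SS n, g ⟪(u : EE n), Ω⟫ * ⟪(u : EE n), w⟫ ^ 2 ∂σ =
      ‖w‖ ^ 2 * ∫ u : SS n, g ⟪(u : EE n), Ω⟫ * (1 - ⟪(u : EE n), Ω⟫ ^ 2) ∂σ := by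
  have h1 : ∀ i : Fin n, _ := fun i => quad_eq hinv Ω g w
    (projPerp Ω (EuclideanSpace.single i 1)) hw (inner_projPerp_self _ _ hΩ)
  have h2 := Finset.sum_congr (rfl : (Finset.univ : Finset (Fin n)) = _) (fun i _ => h1 i)
  rw [← Finset.sum_mul, ← Finset.mul_sum, ← integral_finsetSum] at h2
  · have e1 : ∑ i : Fin n, ‖projPerp Ω (EuclideanSpace.single i 1)‖ ^ 2 = (n : ℝ) - 1 := by
      have : ∀ i : Fin n, ‖projPerp Ω (EuclideanSpace.single i 1)‖ ^ 2 = 1 - Ω i ^ 2 := by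
        intro i
        rw [← real_inner_self_eq_norm_sq, inner_projPerp_right]
        simp only [projPerp, inner_sub_left, inner_smul_left, inner_sub_right, inner_smul_right,
          RCLike.conj_to_real, real_inner_self_eq_norm_sq, hΩ]
        rw [← real_inner_comm (EuclideanSpace.single i 1) Ω, EuclideanSpace.inner_single_right]
        simp
        ring
      simp only [this, Finset.sum_sub_distrib]
      have h3 : ∑ i, Ω i ^ 2 = 1 := by
        rw [← EuclideanSpace.real_norm_sq_eq, hΩ]; norm_num
      simp [h3]
    rw [e1] at h2
    rw [h2]
    congr 2
    ext u
    rw [← Finset.mul_sum]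
    congr 1
    simp only [← inner_projPerp_right]
    have hu : ‖(u : EE n)‖ = 1 := by simp
    simp only [EuclideanSpace.inner_single_right]
    simp only [one_mul, RCLike.conj_to_real]
    rw [← EuclideanSpace.real_norm_sq_eq, ← real_inner_self_eq_norm_sq, inner_projPerp_right]
    simp only [projPerp, inner_sub_left, inner_smul_left, inner_sub_right, inner_smul_right,
          RCLike.conj_to_real, real_inner_self_eq_norm_sq, hΩ, hu]
    ring
  · intro i _
    apply integrable_sphere
    exact hg.mul (by fun_prop)

theorem quad_polar {n : ℕ} {σ : Measure (SS n)} [IsProbabilityMeasure σ]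
    (hinv : RotationInvariant σ)
    (Ω : EE n) (hΩ : ‖Ω‖ = 1) (g : ℝ → ℝ) (hg : Continuous fun u : SS n => g ⟪(u : EE n), Ω⟫)
    (w v : EE n) (hw : ⟪w, Ω⟫ = 0) (hv : ⟪v, Ω⟫ = 0) :
    ((n : ℝ) - 1) * ∫ u : SS n, g ⟪(u : EE n), Ω⟫ * (⟪(u : EE n), w⟫ * ⟪(u : EE n), v⟫) ∂σ =
      ⟪w, v⟫ * ∫ u : SS n, g ⟪(u : EE n), Ω⟫ * (1 - ⟪(u : EE n), Ω⟫ ^ 2) ∂σ := by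
  have h1 := quad_trace hinv Ω hΩ g hg w hw
  have h2 := quad_trace hinv Ω hΩ g hg v hv
  have h3 := quad_trace hinv Ω hΩ g hg (w + v) (by rw [inner_add_left, hw, hv, add_zero])
  have e : ∫ u : SS n, g ⟪(u : EE n), Ω⟫ * ⟪(u : EE n), w + v⟫ ^ 2 ∂σ
     = (∫ u : SS n, g ⟪(u : EE n), Ω⟫ * ⟪(u : EE n), w⟫ ^ 2 ∂σ)
      + (∫ u : SS n, g ⟪(u : EE n), Ω⟫ * ⟪(u : EE n), v⟫ ^ 2 ∂σ)
      + 2 * ∫ u : SS n, g ⟪(u : EE n), Ω⟫ * (⟪(u : EE n), w⟫ * ⟪(u : EE n), v⟫) ∂σ := by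
    rw [← integral_const_mul, ← integral_add, ← integral_add]
    · congr 1
      ext u
      rw [inner_add_right]; ring
    all_goals
      apply integrable_sphere
      first
      | exact hg.mul (by fun_prop)
      | exact (hg.mul (by fun_prop)).add (hg.mul (by fun_prop))
      | exact continuous_const.mul (hg.mul (by fun_prop))
  rw [e, norm_add_sq_real] at h3
  linarith

theorem vec_formula {n : ℕ} {σ : Measure (SS n)} [IsProbabilityMeasure σ]
    (hinv : RotationInvariant σ)
    (Ω : EE n) (hΩ : ‖Ω‖ = 1) (g : ℝ → ℝ) (hg : Continuous fun u : SS n => g ⟪(u : EE n), Ω⟫)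
    (w : EE n) (hw : ⟪w, Ω⟫ = 0) :
    ((n : ℝ) - 1) • ∫ u : SS n, (g ⟪(u : EE n), Ω⟫ * ⟪(u : EE n), w⟫) • projPerp Ω (u : EE n) ∂σ =
      (∫ u : SS n, g ⟪(u : EE n), Ω⟫ * (1 - ⟪(u : EE n), Ω⟫ ^ 2) ∂σ) • w := by
  apply ext_inner_left ℝ
  intro v
  have h1 := quad_polar hinv Ω hΩ g hg w (projPerp Ω v) hw (inner_projPerp_self _ _ hΩ)
  rw [inner_smul_right, inner_smul_right, ← integral_inner]
  · rw [← inner_projPerp_right] at h1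
    have hpw : projPerp Ω w = w := by simp [projPerp, hw]
    rw [hpw, real_inner_comm] at h1
    rw [mul_comm ⟪v, w⟫] at h1
    rw [← h1]
    congr 2
    ext u
    rw [inner_smul_right, real_inner_comm (projPerp Ω _) v, inner_projPerp_right]; ring
  · apply integrable_sphere
    unfold projPerp
    exact (hg.mul (by fun_prop)).smul (by fun_prop)

theorem line_deriv {n : ℕ} {V : Type*} [NormedAddCommGroup V] [NormedSpace ℝ V]
    (f : EE n → V) (hf : Differentiable ℝ f) (x e : EE n) (t : ℝ) :
    HasDerivAt (fun t : ℝ => f (x + t • e)) (fderiv ℝ f (x + t • e) e) t := by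
  have h1 : HasDerivAt (fun t : ℝ => x + t • e) e t := by
    simpa using ((hasDerivAt_id t).smul_const e).const_add x
  exact (hf (x + t • e)).hasFDerivAt.comp_hasDerivAt t h1

theorem line_deriv2 {n : ℕ} {V : Type*} [NormedAddCommGroup V] [NormedSpace ℝ V]
    (f : EE n → V) (hf : ContDiff ℝ 2 f) (x e : EE n) :
    fderiv ℝ (fun y => fderiv ℝ f y e) x e = deriv (deriv (fun t : ℝ => f (x + t • e))) 0 := by
  have h1 : deriv (fun t : ℝ => f (x + t • e)) = fun t => fderiv ℝ f (x + t • e) e := by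
    ext t
    exact (line_deriv f (hf.differentiable (by norm_num)) x e t).deriv
  have h2 : ContDiff ℝ 1 (fun y => fderiv ℝ f y e) :=
    (hf.fderiv_right (m := 1) (by norm_num)).clm_apply contDiff_const
  rw [h1]
  have := (line_deriv (fun y => fderiv ℝ f y e) (h2.differentiable (by norm_num)) x e 0).deriv
  rw [this]
  simp

theorem calc_1d (b a s : ℝ → ℝ) (hb : ContDiff ℝ 2 b) (ha : ContDiff ℝ 2 a)
    (hs : ContDiff ℝ 2 s) (t : ℝ) :
    deriv (deriv (fun t => b t * Real.exp (a t * s t ^ 2))) t =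
      (deriv (deriv b) t + 2 * deriv b t * (deriv a t * s t ^ 2 + 2 * a t * s t * deriv s t)
       + b t * (deriv (deriv a) t * s t ^ 2 + 4 * deriv a t * s t * deriv s t
          + 2 * a t * deriv s t ^ 2 + 2 * a t * s t * deriv (deriv s) t)
       + b t * (deriv a t * s t ^ 2 + 2 * a t * s t * deriv s t) ^ 2)
      * Real.exp (a t * s t ^ 2) := by
  have d1 : ∀ f : ℝ → ℝ, ContDiff ℝ 2 f → ∀ t, HasDerivAt f (deriv f t) t := fun f hf t =>
    (hf.differentiable (by norm_num) t).hasDerivAt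
  have d2 : ∀ f : ℝ → ℝ, ContDiff ℝ 2 f → ∀ t, HasDerivAt (deriv f) (deriv (deriv f) t) t :=
    fun f hf t => by
      have : ContDiff ℝ 1 (deriv f) := ((contDiff_succ_iff_deriv (n := 1)).1 hf).2.2
      exact (this.differentiable (by norm_num) t).hasDerivAt
  have hE : ∀ t, HasDerivAt (fun t => Real.exp (a t * s t ^ 2))
      (Real.exp (a t * s t ^ 2) * (deriv a t * s t ^ 2 + 2 * a t * s t * deriv s t)) t := by
    intro t
    refine (((d1 a ha t).mul ((d1 s hs t).pow 2)).exp).congr_deriv ?_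
    simp only [Pi.mul_apply, Pi.pow_apply]
    push_cast
    ring
  have e1 : deriv (fun t => b t * Real.exp (a t * s t ^ 2)) = fun t =>
      (deriv b t + b t * (deriv a t * s t ^ 2 + 2 * a t * s t * deriv s t))
        * Real.exp (a t * s t ^ 2) := by
    ext t
    refine ((d1 b hb t).mul (hE t)).deriv.trans ?_
    ring
  rw [e1]
  have h3 := ((d2 b hb t).add ((d1 b hb t).mul (((d2 a ha t).mul ((d1 s hs t).pow 2)).add
    ((((d1 a ha t).const_mul 2).mul (d1 s hs t)).mul (d2 s hs t))))).mul (hE t)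
  refine (h3.deriv).trans ?_
  simp only [Pi.mul_apply, Pi.pow_apply, Pi.add_apply]
  push_cast
  ring

theorem Z_indep {n : ℕ} {σ : Measure (SS n)} (hinv : RotationInvariant σ)
    (a b : EE n) (hab : ‖a‖ = ‖b‖) (t : ℝ) :
    ∫ v : SS n, Real.exp (t * ⟪(v : EE n), a⟫ ^ 2) ∂σ =
     ∫ v : SS n, Real.exp (t * ⟪(v : EE n), b⟫ ^ 2) ∂σ := by
  set R := Submodule.reflection (Submodule.span ℝ {a - b})ᗮ with hR
  have hRa : R a = b := Submodule.reflection_sub hab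
  rw [← integral_sphereMap hinv R (fun u => Real.exp (t * ⟪(u : EE n), b⟫ ^ 2))]
  congr 1
  ext u
  have e2 : ⟪((sphereMap R u : SS n) : EE n), b⟫ = ⟪(u : EE n), a⟫ := by
    conv_lhs => rw [← hRa]
    exact R.inner_map_map _ _
  rw [e2]

noncomputable def Zf {n : ℕ} (σ : Measure (SS n)) (w : EE n) (t : ℝ) : ℝ :=
  ∫ v : SS n, Real.exp (t * ⟪(v : EE n), w⟫ ^ 2) ∂σ

theorem Z_int {n : ℕ} (σ : Measure (SS n)) [IsProbabilityMeasure σ] (w : EE n) :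
    ProbabilityTheory.integrableExpSet (fun v : SS n => ⟪(v : EE n), w⟫ ^ 2) σ = Set.univ := by
  ext t
  simp only [ProbabilityTheory.integrableExpSet, Set.mem_ofPred_eq, Set.mem_univ, iff_true]
  apply integrable_sphere
  fun_prop

theorem Zf_pos {n : ℕ} (σ : Measure (SS n)) [IsProbabilityMeasure σ] (w : EE n) (t : ℝ) :
    0 < Zf σ w t := by
  apply ProbabilityTheory.mgf_pos (X := fun v : SS n => ⟪(v : EE n), w⟫ ^ 2)
  apply integrable_sphere
  fun_prop

theorem Zf_contDiff {n : ℕ} (σ : Measure (SS n)) [IsProbabilityMeasure σ] (w : EE n) :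
    ContDiff ℝ 2 (Zf σ w) := by
  rw [contDiff_iff_contDiffAt]
  intro t
  exact (ProbabilityTheory.analyticAt_mgf (μ := σ) (t := t)
    (X := fun v : SS n => ⟪(v : EE n), w⟫ ^ 2) (by rw [Z_int]; simp)).contDiffAt

theorem Zf_deriv {n : ℕ} (σ : Measure (SS n)) [IsProbabilityMeasure σ] (w : EE n) (t : ℝ) :
    HasDerivAt (Zf σ w) (Zf σ w t * dCoeff20 σ t w) t := by
  have h := ProbabilityTheory.hasDerivAt_mgf (μ := σ) (t := t)
    (X := fun v : SS n => ⟪(v : EE n), w⟫ ^ 2) (by rw [Z_int]; simp)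
  have e : Zf σ w t * dCoeff20 σ t w =
      ∫ v : SS n, ⟪(v : EE n), w⟫ ^ 2 * Real.exp (t * ⟪(v : EE n), w⟫ ^ 2) ∂σ := by
    unfold dCoeff20
    rw [← integral_const_mul]
    congr 1
    ext u
    have := (Zf_pos σ w t).ne'
    unfold gibbs
    change Zf σ w t * (_ * (_ / Zf σ w t)) = _
    field_simp
  rw [e]
  exact h

/-- second partial derivative of the density -/
theorem pd2_formula {n : ℕ} {σ : Measure (SS n)} [IsProbabilityMeasure σ]
    (hinv : RotationInvariant σ)
    (ρ : EE n → ℝ) (hρ : ContDiff ℝ 2 ρ)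
    (Ω : EE n → EE n) (hΩdiff : ContDiff ℝ 2 Ω)
    (hΩ : ∀ x, ‖Ω x‖ = 1)
    (η : ℝ → ℝ) (hη : ContDiff ℝ 2 η) (x : EE n) (j : Fin n) :
    ⟪pdV j Ω x, Ω x⟫ = 0 ∧
    ∃ α β γ : ℝ, ∀ u : SS n,
      pd j (fun y => pd j (fun z => ρ z * gibbs σ (η (ρ z)) (Ω z) u) y) x =
      gibbs σ (η (ρ x)) (Ω x) u *
        ((α + β * ⟪(u : EE n), Ω x⟫ ^ 2 + γ * ⟪(u : EE n), Ω x⟫ ^ 4 +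
          (2 * η (ρ x) * ρ x + 4 * η (ρ x) ^ 2 * ρ x * ⟪(u : EE n), Ω x⟫ ^ 2) *
            ⟪(u : EE n), pdV j Ω x⟫ ^ 2)
        + ⟪(u : EE n), Ω x⟫ * ⟪(u : EE n),
            (4 * η (ρ x) * (pd j ρ x - ρ x * dCoeff20 σ (η (ρ x)) (Ω x) *
              (deriv η (ρ x) * pd j ρ x)) + 4 * ρ x * (deriv η (ρ x) * pd j ρ x)) • pdV j Ω x
            + (2 * η (ρ x) * ρ x) • projPerp (Ω x) (pdV j (fun y => pdV j Ω y) x)⟫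
        + ⟪(u : EE n), Ω x⟫ ^ 3 * ⟪(u : EE n),
            (4 * ρ x * η (ρ x) * (deriv η (ρ x) * pd j ρ x)) • pdV j Ω x⟫) := by
  set e : EE n := EuclideanSpace.single j 1 with he
  set Z := Zf σ (Ω x) with hZ
  have hZp : ∀ t, 0 < Z t := Zf_pos σ (Ω x)
  have hZc : ContDiff ℝ 2 Z := Zf_contDiff σ (Ω x)
  have hgib : ∀ z (u : SS n), gibbs σ (η (ρ z)) (Ω z) u =
      Real.exp (η (ρ z) * ⟪(u : EE n), Ω z⟫ ^ 2) / Z (η (ρ z)) := by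
    intro z u
    unfold gibbs
    rw [Z_indep hinv (Ω z) (Ω x) (by rw [hΩ, hΩ])]
    rfl
  have hℓ : ContDiff ℝ 2 (fun t : ℝ => x + t • e) := by fun_prop
  set r : ℝ → ℝ := fun t => ρ (x + t • e) with hr
  set ω : ℝ → EE n := fun t => Ω (x + t • e) with hω
  have hrc : ContDiff ℝ 2 r := hρ.comp hℓ
  have hωc : ContDiff ℝ 2 ω := hΩdiff.comp hℓ
  set a : ℝ → ℝ := fun t => η (r t) with ha
  have hac : ContDiff ℝ 2 a := hη.comp hrc
  set b : ℝ → ℝ := fun t => r t / Z (a t) with hb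
  have hbc : ContDiff ℝ 2 b := hrc.div (hZc.comp hac) (fun t => (hZp _).ne')
  have hr0 : r 0 = ρ x := by simp [hr]
  have hω0 : ω 0 = Ω x := by simp [hω]
  have hr1 : HasDerivAt r (pd j ρ x) 0 := by
    simpa [pd] using line_deriv ρ (hρ.differentiable (by norm_num)) x e 0
  have hω1 : ∀ t, HasDerivAt ω (pdV j Ω (x + t • e)) t := by
    intro t
    exact line_deriv Ω (hΩdiff.differentiable (by norm_num)) x e t
  have hω2 : deriv (deriv ω) 0 = pdV j (fun y => pdV j Ω y) x :=
    (line_deriv2 Ω hΩdiff x e).symm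
  have ha0 : a 0 = η (ρ x) := by simp [ha, hr0]
  have ha1 : HasDerivAt a (deriv η (ρ x) * pd j ρ x) 0 := by
    have : HasDerivAt η (deriv η (r 0)) (r 0) :=
      (hη.differentiable (by norm_num) _).hasDerivAt
    have := this.comp 0 hr1
    rwa [hr0] at this
  have hb1 := hr1.div ((Zf_deriv σ (Ω x) (a 0)).comp 0 ha1) (hZp _).ne'
  have hperp : ⟪pdV j Ω x, Ω x⟫ = 0 := by
    have h0 := hω1 0
    have h1 := h0.inner ℝ h0
    have h2 : (fun t => ⟪ω t, ω t⟫) = fun _ => (1 : ℝ) := by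
      ext t
      rw [real_inner_self_eq_norm_sq]; simp [hω, hΩ]
    rw [h2] at h1
    have := h1.unique (hasDerivAt_const _ _)
    rw [hω0, zero_smul, add_zero, real_inner_comm] at this
    linarith
  refine ⟨hperp, ?_⟩
  refine ⟨Z (a 0) * deriv (deriv b) 0,
    Z (a 0) * (2 * deriv b 0 * deriv a 0 + b 0 * deriv (deriv a) 0
      + b 0 * 2 * a 0 * ⟪Ω x, pdV j (fun y => pdV j Ω y) x⟫),
    Z (a 0) * (b 0 * deriv a 0 ^ 2), ?_⟩
  intro u
  set s : ℝ → ℝ := fun t => ⟪(u : EE n), ω t⟫ with hs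
  have hsc : ContDiff ℝ 2 s := contDiff_const.inner ℝ hωc
  have hs1 : ∀ t, HasDerivAt s ⟪(u : EE n), deriv ω t⟫ t := by
    intro t
    have := (hasDerivAt_const t (u : EE n)).inner ℝ
      ((hωc.differentiable (by norm_num) t).hasDerivAt)
    simpa using this
  have hs1' : deriv s = fun t => ⟪(u : EE n), deriv ω t⟫ := by
    ext t; exact (hs1 t).deriv
  have hs2 : deriv (deriv s) 0 = ⟪(u : EE n), pdV j (fun y => pdV j Ω y) x⟫ := by
    rw [hs1', ← hω2]
    have hd : ContDiff ℝ 1 (deriv ω) := ((contDiff_succ_iff_deriv (n := 1)).1 hωc).2.2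
    have := (hasDerivAt_const 0 (u : EE n)).inner ℝ
      ((hd.differentiable (by norm_num) 0).hasDerivAt)
    simpa using this.deriv
  have hs10 : deriv s 0 = ⟪(u : EE n), pdV j Ω x⟫ := by
    rw [hs1']
    simp only
    rw [(hω1 0).deriv]; simp
  have hs0 : s 0 = ⟪(u : EE n), Ω x⟫ := by simp [hs, hω0]
  have hfun : (fun z => ρ z * gibbs σ (η (ρ z)) (Ω z) u) =
      fun z => ρ z / Z (η (ρ z)) * Real.exp (η (ρ z) * ⟪(u : EE n), Ω z⟫ ^ 2) := by
    ext z; rw [hgib]; ring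
  have hfc : ContDiff ℝ 2
      (fun z => ρ z / Z (η (ρ z)) * Real.exp (η (ρ z) * ⟪(u : EE n), Ω z⟫ ^ 2)) := by
    refine (hρ.div (hZc.comp (hη.comp hρ)) (fun t => (hZp _).ne')).mul ?_
    exact ((hη.comp hρ).mul ((contDiff_const.inner ℝ hΩdiff).pow 2)).exp
  rw [hfun]
  have key := (line_deriv2 _ hfc x e).trans (calc_1d b a s hbc hac hsc 0)
  refine Eq.trans key ?_
  rw [hgib, hs2, hs10, hs0, ha0, ha1.deriv]
  have hb0 : b 0 = ρ x / Z (η (ρ x)) := by simp [hb, hr0, ha0]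
  have hb1' : deriv b 0 = (pd j ρ x - ρ x * dCoeff20 σ (η (ρ x)) (Ω x) *
              (deriv η (ρ x) * pd j ρ x)) / Z (η (ρ x)) := by
    have hz := (hZp (η (ρ x))).ne'
    refine hb1.deriv.trans ?_
    simp only [Function.comp_apply, hr0, ha0]
    rw [← hZ]
    field_simp
  rw [hb0, hb1']
  have hz := (hZp (η (ρ x))).ne'
  simp only [projPerp, inner_add_right, inner_sub_right, inner_smul_right]
  rw [real_inner_comm (Ω x) (pdV j (fun y => pdV j Ω y) x)]
  field_simp
  ring

theorem I5_term {n : ℕ} {σ : Measure (SS n)} [IsProbabilityMeasure σ]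
    (hinv : RotationInvariant σ)
    (ρ : EE n → ℝ) (hρ : ContDiff ℝ 2 ρ)
    (Ω : EE n → EE n) (hΩdiff : ContDiff ℝ 2 Ω)
    (hΩ : ∀ x, ‖Ω x‖ = 1)
    (η : ℝ → ℝ) (hη : ContDiff ℝ 2 η)
    (h : ℝ → ℝ) (hcont : ContinuousOn h (Set.Icc (-1) 1)) (x : EE n) (j : Fin n) :
    Integrable (fun u : SS n =>
      (pd j (fun y => pd j (fun z => ρ z * gibbs σ (η (ρ z)) (Ω z) u) y) x) •
        (h ⟪(u : EE n), Ω x⟫ • projPerp (Ω x) (u : EE n))) σ ∧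
    ((n : ℝ) - 1) • ∫ u : SS n,
      (pd j (fun y => pd j (fun z => ρ z * gibbs σ (η (ρ z)) (Ω z) u) y) x) •
        (h ⟪(u : EE n), Ω x⟫ • projPerp (Ω x) (u : EE n)) ∂σ =
      (2 * η (ρ x) * ρ x * cCoeff σ h (η (ρ x)) (Ω x) 1) •
        projPerp (Ω x) (pdV j (fun y => pdV j Ω y) x) +
      ((4 * η (ρ x) * (pd j ρ x - ρ x * dCoeff20 σ (η (ρ x)) (Ω x) *
              (deriv η (ρ x) * pd j ρ x)) + 4 * ρ x * (deriv η (ρ x) * pd j ρ x)) *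
          cCoeff σ h (η (ρ x)) (Ω x) 1 +
        (4 * ρ x * η (ρ x) * (deriv η (ρ x) * pd j ρ x)) *
          cCoeff σ h (η (ρ x)) (Ω x) 3) • pdV j Ω x := by
  obtain ⟨hperp, α, β, γ, hform⟩ := pd2_formula hinv ρ hρ Ω hΩdiff hΩ η hη x j
  simp only [hform]
  generalize dCoeff20 σ (η (ρ x)) (Ω x) = d
  set W1 : EE n := (4 * η (ρ x) * (pd j ρ x - ρ x * d *
              (deriv η (ρ x) * pd j ρ x)) + 4 * ρ x * (deriv η (ρ x) * pd j ρ x)) • pdV j Ω x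
            + (2 * η (ρ x) * ρ x) • projPerp (Ω x) (pdV j (fun y => pdV j Ω y) x) with hW1
  set W3 : EE n := (4 * ρ x * η (ρ x) * (deriv η (ρ x) * pd j ρ x)) • pdV j Ω x with hW3
  have hW1p : ⟪W1, Ω x⟫ = 0 := by
    rw [hW1, inner_add_left, inner_smul_left, inner_smul_left, hperp,
      inner_projPerp_self _ _ (hΩ x)]
    simp
  have hW3p : ⟪W3, Ω x⟫ = 0 := by
    rw [hW3, inner_smul_left, hperp]
    simp
  set q := pdV j Ω x with hq
  set w := Ω x with hw
  have hw1 : ‖w‖ = 1 := hΩ x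
  set a := η (ρ x) with ha
  set Z := Zf σ w a with hZ
  have hgib : ∀ u : SS n, gibbs σ a w u = Real.exp (a * ⟪(u : EE n), w⟫ ^ 2) / Z :=
    fun u => rfl
  have hhc : Continuous fun u : SS n => h ⟪(u : EE n), w⟫ := by
    apply hcont.comp_continuous (by fun_prop)
    intro u
    have := abs_real_inner_le_norm (u : EE n) w
    rw [hw1, show ‖(u : EE n)‖ = 1 by simp, mul_one] at this
    exact abs_le.mp this
  have hcc : ∀ k : ℕ, Continuous fun u : SS n => (fun r : ℝ =>
      r ^ k * h r * (Real.exp (a * r ^ 2) / Z)) ⟪(u : EE n), w⟫ := by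
    intro k
    exact (Continuous.mul (by fun_prop) hhc).mul (by fun_prop)
  have hck : ∀ k : ℕ, ∫ u : SS n, (fun r : ℝ =>
      r ^ k * h r * (Real.exp (a * r ^ 2) / Z)) ⟪(u : EE n), w⟫ *
        (1 - ⟪(u : EE n), w⟫ ^ 2) ∂σ = cCoeff σ h a w k := by
    intro k
    unfold cCoeff
    congr 1
    ext u
    rw [hgib]; ring
  have v1 := vec_formula hinv w hw1 (fun r : ℝ => r ^ 1 * h r * (Real.exp (a * r ^ 2) / Z))
    (hcc 1) W1 hW1p
  have v3 := vec_formula hinv w hw1 (fun r : ℝ => r ^ 3 * h r * (Real.exp (a * r ^ 2) / Z))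
    (hcc 3) W3 hW3p
  rw [hck 1] at v1
  rw [hck 3] at v3
  set c := 2 * a * ρ x
  set c' := 4 * a ^ 2 * ρ x
  have v0 := even_vanish hinv w hw1 (fun u : SS n =>
    h ⟪(u : EE n), w⟫ * (Real.exp (a * ⟪(u : EE n), w⟫ ^ 2) / Z) *
    (α + β * ⟪(u : EE n), w⟫ ^ 2 + γ * ⟪(u : EE n), w⟫ ^ 4 +
      (c + c' * ⟪(u : EE n), w⟫ ^ 2) * ⟪(u : EE n), q⟫ ^ 2)) (by
    intro u v huv
    have e1 : ⟪(v : EE n), w⟫ = ⟪(u : EE n), w⟫ := by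
      rw [huv, inner_sub_left, inner_smul_left, real_inner_self_eq_norm_sq, hw1]
      simp only [RCLike.conj_to_real]
      ring
    have e2 : ⟪(v : EE n), q⟫ = - ⟪(u : EE n), q⟫ := by
      rw [huv, inner_sub_left, inner_smul_left, real_inner_comm q w, hperp]
      simp
    simp only [e1, e2, neg_sq])
  have hPc : Continuous fun u : SS n => projPerp w (u : EE n) := by
    unfold projPerp; fun_prop
  have i0 : Integrable (fun u : SS n => (h ⟪(u : EE n), w⟫ *
      (Real.exp (a * ⟪(u : EE n), w⟫ ^ 2) / Z) *
    (α + β * ⟪(u : EE n), w⟫ ^ 2 + γ * ⟪(u : EE n), w⟫ ^ 4 +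
      (c + c' * ⟪(u : EE n), w⟫ ^ 2) * ⟪(u : EE n), q⟫ ^ 2)) • projPerp w (u : EE n)) σ := by
    apply integrable_sphere
    exact ((hhc.mul (by fun_prop)).mul (by fun_prop)).smul hPc
  have ik : ∀ (k : ℕ) (W : EE n), Integrable (fun u : SS n => ((fun r : ℝ =>
      r ^ k * h r * (Real.exp (a * r ^ 2) / Z)) ⟪(u : EE n), w⟫ * ⟪(u : EE n), W⟫) •
        projPerp w (u : EE n)) σ := by
    intro k W
    apply integrable_sphere
    exact ((hcc k).mul (by fun_prop)).smul hPc
  have i1 := ik 1 W1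
  have i3 := ik 3 W3
  have hsplit : (fun u : SS n => (gibbs σ a w u *
        ((α + β * ⟪(u : EE n), w⟫ ^ 2 + γ * ⟪(u : EE n), w⟫ ^ 4 +
          (c + c' * ⟪(u : EE n), w⟫ ^ 2) * ⟪(u : EE n), q⟫ ^ 2)
        + ⟪(u : EE n), w⟫ * ⟪(u : EE n), W1⟫
        + ⟪(u : EE n), w⟫ ^ 3 * ⟪(u : EE n), W3⟫)) •
        (h ⟪(u : EE n), w⟫ • projPerp w (u : EE n))) =
      fun u : SS n => ((h ⟪(u : EE n), w⟫ *
      (Real.exp (a * ⟪(u : EE n), w⟫ ^ 2) / Z) *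
    (α + β * ⟪(u : EE n), w⟫ ^ 2 + γ * ⟪(u : EE n), w⟫ ^ 4 +
      (c + c' * ⟪(u : EE n), w⟫ ^ 2) * ⟪(u : EE n), q⟫ ^ 2)) • projPerp w (u : EE n) +
      ((fun r : ℝ =>
      r ^ 1 * h r * (Real.exp (a * r ^ 2) / Z)) ⟪(u : EE n), w⟫ * ⟪(u : EE n), W1⟫) •
        projPerp w (u : EE n)) +
      ((fun r : ℝ =>
      r ^ 3 * h r * (Real.exp (a * r ^ 2) / Z)) ⟪(u : EE n), w⟫ * ⟪(u : EE n), W3⟫) •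
        projPerp w (u : EE n) := by
    funext u
    rw [hgib, smul_smul, ← add_smul, ← add_smul]
    congr 1
    ring
  rw [hsplit]
  refine ⟨(i0.add i1).add i3, ?_⟩
  have hI := (integral_add (i0.add i1) i3).trans (congrArg (fun z => z + _) (integral_add i0 i1))
  refine (congrArg (fun z => ((n : ℝ) - 1) • z) hI).trans ?_
  beta_reduce
  rw [v0, zero_add, smul_add, v1, v3, hW1, hW3]
  module

/-- The term `I₅ = ∫ Δ_x(ρ G_{η(ρ)A_Ω}) ψ dσ = (2η c₁₂/(n−1)) ρ P_{Ω⊥}Δ_xΩ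
+ (4/(n−1)) (ρ η′ (c₁₂ + η(c₃₂ − d₂₀ c₁₂)) + η c₁₂) (∇_xρ·∇_x)Ω`, where
`ψ = h(u·Ω) P_{Ω⊥}u` is the Generalized Collision Invariant with `h` odd. -/
theorem laplacian_I5 (n : ℕ) (hn : 2 ≤ n)
    (σ : Measure (sphere (0 : EuclideanSpace ℝ (Fin n)) 1))
    (hprob : IsProbabilityMeasure σ) (hinv : RotationInvariant σ)
    (ρ : EuclideanSpace ℝ (Fin n) → ℝ) (hρ : ContDiff ℝ 2 ρ)
    (Ω : EuclideanSpace ℝ (Fin n) → EuclideanSpace ℝ (Fin n)) (hΩdiff : ContDiff ℝ 2 Ω)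
    (hΩ : ∀ x, ‖Ω x‖ = 1)
    (η : ℝ → ℝ) (hη : ContDiff ℝ 2 η)
    (h : ℝ → ℝ) (hcont : ContinuousOn h (Set.Icc (-1) 1))
    (hodd : ∀ r ∈ Set.Icc (-1 : ℝ) 1, h (-r) = -h r) :
    ∀ x : EuclideanSpace ℝ (Fin n),
      (∫ u : sphere (0 : EuclideanSpace ℝ (Fin n)) 1,
          (∑ j : Fin n,
              pd j (fun y => pd j (fun z => ρ z * gibbs σ (η (ρ z)) (Ω z) u) y) x) •
            (h ⟪(u : EuclideanSpace ℝ (Fin n)), Ω x⟫ •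
              projPerp (Ω x) (u : EuclideanSpace ℝ (Fin n))) ∂σ)
        = ((2 * η (ρ x) * cCoeff σ h (η (ρ x)) (Ω x) 1) / ((n : ℝ) - 1)) •
            (ρ x • projPerp (Ω x) (∑ j : Fin n, pdV j (fun y => pdV j Ω y) x))
          + ((4 / ((n : ℝ) - 1)) *
              (ρ x * deriv η (ρ x) *
                  (cCoeff σ h (η (ρ x)) (Ω x) 1 +
                    η (ρ x) * (cCoeff σ h (η (ρ x)) (Ω x) 3
                      - dCoeff20 σ (η (ρ x)) (Ω x) * cCoeff σ h (η (ρ x)) (Ω x) 1))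
                + η (ρ x) * cCoeff σ h (η (ρ x)) (Ω x) 1)) •
            (∑ j : Fin n, pd j ρ x • pdV j Ω x) := by
  intro x
  have hn1 : (n : ℝ) - 1 ≠ 0 := by
    have : (2 : ℝ) ≤ n := by exact_mod_cast hn
    linarith
  have hj := fun j => I5_term hinv ρ hρ Ω hΩdiff hΩ η hη h hcont x j
  simp only [Finset.sum_smul]
  rw [integral_finsetSum _ (fun j _ => (hj j).1)]
  have hP : projPerp (Ω x) (∑ j : Fin n, pdV j (fun y => pdV j Ω y) x) =
      ∑ j : Fin n, projPerp (Ω x) (pdV j (fun y => pdV j Ω y) x) := by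
    simp only [projPerp, sum_inner, Finset.sum_smul, Finset.sum_sub_distrib]
  rw [hP, Finset.smul_sum, Finset.smul_sum, Finset.smul_sum, ← Finset.sum_add_distrib]
  refine Finset.sum_congr rfl (fun j _ => ?_)
  have h2 := (hj j).2
  apply smul_right_injective _ hn1
  simp only
  rw [h2]
  simp only [smul_add, smul_smul]
  congr 1
  · congr 1
    field_simp
  · congr 1
    field_simp
    ring
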